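/- arXiv:2508.15494 — 2 statements merged into one kernel-verified Lean document; each statement's English description precedes it below -/
import Mathlib

section
/- In the continual ridge setting, suppose the design matrices X_1,…,X_T are fixed, ε_1,…,ε_T are integrable random vectors with E ε_t = 0 for each t, and y_t = X_tβ + ε_t for a fixed β ∈ ℝ^p. Then the expectation of the continual ridge estimator satisfies E β̂_T = β − A_TA_{T−1}⋯A_1β. -/
open Matrix MeasureTheory
open scoped BigOperators

noncomputable section

/-- ordered descending product `A_t * A_{t-1} * ⋯ * A_{s+1}` (identity if `t ≤ s`). -/
def prodDesc {p : ℕ} (A : ℕ → Matrix (Fin p) (Fin p) ℝ) (s t : ℕ) :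
    Matrix (Fin p) (Fin p) ℝ :=
  (((List.range' (s+1) (t - s)).reverse).map A).prod

lemma prodDesc_succ {p : ℕ} (A : ℕ → Matrix (Fin p) (Fin p) ℝ) {s t : ℕ} (h : s ≤ t) :
    prodDesc A s (t + 1) = A (t + 1) * prodDesc A s t := by
  have hs : s + 1 + (t - s) = t + 1 := by omega
  simp [prodDesc, Nat.succ_sub h, List.range'_concat, hs]

lemma integrable_mulVec {Ω m n : Type*} [Fintype n] [MeasurableSpace Ω] {μ : Measure Ω}
    (M : Matrix m n ℝ) {f : Ω → n → ℝ} (hf : ∀ j, Integrable (fun ω => f ω j) μ) (i : m) :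
    Integrable (fun ω => (M *ᵥ f ω) i) μ :=
  integrable_finsetSum _ fun j _ => (hf j).const_mul (M i j)

lemma integral_mulVec {Ω m n : Type*} [Fintype n] [MeasurableSpace Ω] {μ : Measure Ω}
    (M : Matrix m n ℝ) {f : Ω → n → ℝ} (hf : ∀ j, Integrable (fun ω => f ω j) μ) (i : m) :
    ∫ ω, (M *ᵥ f ω) i ∂μ = (M *ᵥ fun j => ∫ ω, f ω j ∂μ) i := by
  simp only [mulVec, dotProduct]
  rw [integral_finsetSum _ fun j _ => (hf j).const_mul (M i j)]
  simp only [integral_const_mul]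

lemma isUnit_det_gram_add_smul_one {m n : Type*} [Fintype m] [Fintype n] [DecidableEq n]
    (X : Matrix m n ℝ) {c l : ℝ} (hc : 0 ≤ c) (hl : 0 < l) :
    IsUnit (c • (Xᵀ * X) + l • (1 : Matrix n n ℝ)).det := by
  have h : (Xᵀ * X).PosSemidef := by
    simpa using Matrix.posSemidef_conjTranspose_mul_self X
  exact (Matrix.isUnit_iff_isUnit_det _).1
    ((Matrix.PosDef.posSemidef_add (h.smul hc) (Matrix.PosDef.one.smul hl)).isUnit)

/-- The ridge estimator is the true coefficient, minus the shrinkage bias, plus linear noise. -/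
lemma ridge_mulVec_eq {m n : Type*} [Fintype m] [Fintype n] [DecidableEq n]
    (X : Matrix m n ℝ) {c l : ℝ} (hc : 0 ≤ c) (hl : 0 < l) (β : n → ℝ) (e : m → ℝ) :
    (c • (Xᵀ * X) + l • (1 : Matrix n n ℝ))⁻¹ *ᵥ (c • (Xᵀ *ᵥ (X *ᵥ β + e))) =
      β - (l • (c • (Xᵀ * X) + l • (1 : Matrix n n ℝ))⁻¹) *ᵥ β
        + ((c • (Xᵀ * X) + l • (1 : Matrix n n ℝ))⁻¹ * (c • Xᵀ)) *ᵥ e := by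
  have hM := isUnit_det_gram_add_smul_one X hc hl
  set M := c • (Xᵀ * X) + l • (1 : Matrix n n ℝ) with hMdef
  have hS : c • (Xᵀ *ᵥ (X *ᵥ β + e)) = M *ᵥ β - l • β + (c • Xᵀ) *ᵥ e := by
    simp [hMdef, mulVec_add, add_mulVec, smul_mulVec, mulVec_mulVec]
  rw [hS, mulVec_add, mulVec_sub, mulVec_mulVec, nonsing_inv_mul _ hM, one_mulVec,
    mulVec_mulVec, mulVec_smul, smul_mulVec]

/-- In the continual ridge setting with fixed designs, mean-zero
integrable noise and `y_t = X_t β + ε_t`, the expectation of the continual ridge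
estimator satisfies `E β̂_T = β − A_T A_{T−1} ⋯ A_1 β`. -/
theorem continual_ridge_mean
    {Ω : Type} [MeasurableSpace Ω] (μ : Measure Ω) [IsProbabilityMeasure μ]
    (T p : ℕ) (n : ℕ → ℕ)
    (X : (t : ℕ) → Matrix (Fin (n t)) (Fin p) ℝ)
    (β : Fin p → ℝ)
    (ε : (t : ℕ) → Ω → Fin (n t) → ℝ)
    (hεint : ∀ t i, 1 ≤ t → t ≤ T → Integrable (fun ω => ε t ω i) μ)
    (hεmean : ∀ t i, 1 ≤ t → t ≤ T → ∫ ω, ε t ω i ∂μ = 0)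
    (y : (t : ℕ) → Ω → Fin (n t) → ℝ)
    (hy : ∀ t ω, 1 ≤ t → t ≤ T → y t ω = (X t) *ᵥ β + ε t ω)
    (lam : ℕ → ℝ) (hlam : ∀ t, 1 ≤ t → t ≤ T → 0 < lam t)
    (ridge : ℕ → Ω → Fin p → ℝ)
    (hridge : ∀ t ω, 1 ≤ t → t ≤ T →
      ridge t ω = ((n t : ℝ)⁻¹ • ((X t)ᵀ * X t) + lam t • (1 : Matrix (Fin p) (Fin p) ℝ))⁻¹
        *ᵥ ((n t : ℝ)⁻¹ • ((X t)ᵀ *ᵥ y t ω)))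
    (A : ℕ → Matrix (Fin p) (Fin p) ℝ)
    (hA : ∀ t, 1 ≤ t → t ≤ T →
      A t = lam t • ((n t : ℝ)⁻¹ • ((X t)ᵀ * X t) + lam t • (1 : Matrix (Fin p) (Fin p) ℝ))⁻¹)
    (βhat : ℕ → Ω → Fin p → ℝ)
    (hβ0 : ∀ ω, βhat 0 ω = 0)
    (hβrec : ∀ t ω, 1 ≤ t → t ≤ T → βhat t ω = ridge t ω + (A t) *ᵥ (βhat (t - 1) ω)) :
    ∀ i, ∫ ω, βhat T ω i ∂μ = (β - (prodDesc A 0 T) *ᵥ β) i := by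
  have key : ∀ t, t ≤ T → (∀ i, Integrable (fun ω => βhat t ω i) μ) ∧
      (fun i => ∫ ω, βhat t ω i ∂μ) = β - prodDesc A 0 t *ᵥ β := by
    intro t
    induction t with
    | zero =>
      intro _
      simp only [hβ0]
      refine ⟨fun i => by simp, ?_⟩
      ext i
      simp [prodDesc]
    | succ t ih =>
      intro ht
      obtain ⟨hint, hmean⟩ := ih (by omega)
      have h1 : 1 ≤ t + 1 := by omega
      obtain ⟨N, hN⟩ : ∃ N : Matrix (Fin p) (Fin (n (t + 1))) ℝ, ∀ ω, βhat (t + 1) ω =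
          β - A (t + 1) *ᵥ β + N *ᵥ ε (t + 1) ω + A (t + 1) *ᵥ βhat t ω := by
        refine ⟨((n (t + 1) : ℝ)⁻¹ • ((X (t + 1))ᵀ * X (t + 1)) + lam (t + 1) •
          (1 : Matrix (Fin p) (Fin p) ℝ))⁻¹ * ((n (t + 1) : ℝ)⁻¹ • (X (t + 1))ᵀ), fun ω => ?_⟩
        rw [hβrec _ ω h1 ht, hridge _ ω h1 ht, hy _ ω h1 ht, hA _ h1 ht,
          ridge_mulVec_eq _ (by positivity) (hlam _ h1 ht), Nat.add_sub_cancel]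
      have hnoise := integrable_mulVec N fun j => hεint (t + 1) j h1 ht
      have hprev := integrable_mulVec (A (t + 1)) hint
      have hfix := fun i => (integrable_const ((β - A (t + 1) *ᵥ β) i)).add (hnoise i)
      simp only [hN]
      refine ⟨fun i => (hfix i).add (hprev i), ?_⟩
      ext i
      have hsum := integral_add (hfix i) (hprev i)
      have hsum' := integral_add (integrable_const (μ := μ) ((β - A (t + 1) *ᵥ β) i)) (hnoise i)
      have hzero : (fun j => ∫ ω, ε (t + 1) ω j ∂μ) = 0 :=
        funext fun j => hεmean (t + 1) j h1 ht
      rw [integral_mulVec N fun j => hεint (t + 1) j h1 ht, hzero, mulVec_zero] at hsum'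
      rw [integral_mulVec _ hint, hmean] at hsum
      simp only [Pi.add_apply] at hsum ⊢
      rw [hsum, hsum', prodDesc_succ A (Nat.zero_le t), mulVec_sub, mulVec_mulVec]
      simp
  exact fun i => congrFun (key T le_rfl).2 i
end
end

section
/- (Bias part of Lemma 1.) In the continual ridge setting, suppose X_1,…,X_T are fixed, ε_1,…,ε_T are integrable random vectors with E ε_t = 0, y_t = X_tβ + ε_t for a fixed β ∈ ℝ^p, and Σ_0 ∈ ℝ^{p×p} is symmetric positive semidefinite. Then the bias term B := (E β̂_T − β)^⊤ Σ_0 (E β̂_T − β) equals β^⊤A_1A_2⋯A_TΣ_0A_T⋯A_2A_1β. -/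
open Matrix MeasureTheory
open scoped BigOperators

noncomputable section

/-- ordered ascending product `A_{s+1} * ⋯ * A_t` (identity if `t ≤ s`). -/
def prodAsc {p : ℕ} (A : ℕ → Matrix (Fin p) (Fin p) ℝ) (s t : ℕ) :
    Matrix (Fin p) (Fin p) ℝ :=
  ((List.range' (s+1) (t - s)).map A).prod

/-- Integration against a measure commutes with applying a fixed matrix, coordinatewise. -/
theorem integrable_mulVec_and_integral_mulVec {Ω m k : Type*} [MeasurableSpace Ω] [Fintype k]
    {μ : Measure Ω} (M : Matrix m k ℝ) {f : Ω → k → ℝ}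
    (hf : ∀ j, Integrable (fun ω => f ω j) μ) (i : m) :
    Integrable (fun ω => (M *ᵥ f ω) i) μ ∧
      ∫ ω, (M *ᵥ f ω) i ∂μ = (M *ᵥ fun j => ∫ ω, f ω j ∂μ) i := by
  have h : ∀ j ∈ Finset.univ, Integrable (fun ω => M i j * f ω j) μ :=
    fun j _ => (hf j).const_mul _
  refine ⟨integrable_finsetSum _ h, ?_⟩
  simp only [mulVec, dotProduct]
  rw [integral_finsetSum _ h]
  simp only [integral_const_mul]

theorem posDef_smul_transpose_mul_self_add_smul_one {m k : Type*} [Fintype m] [Fintype k]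
    [DecidableEq k] (X : Matrix m k ℝ) {c l : ℝ} (hc : 0 ≤ c) (hl : 0 < l) :
    (c • (Xᵀ * X) + l • (1 : Matrix k k ℝ)).PosDef := by
  have h : (Xᵀ * X).PosSemidef := by
    simpa using posSemidef_conjTranspose_mul_self X
  exact (PosDef.one.smul hl).posSemidef_add (h.smul hc)

/-- The error of one ridge step started from `b`, when the response is `X β + e`. -/
theorem ridge_step_error {m k : Type*} [Fintype m] [Fintype k] [DecidableEq k]
    (X : Matrix m k ℝ) {c l : ℝ} (hc : 0 ≤ c) (hl : 0 < l) (β b : k → ℝ) (e : m → ℝ) :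
    (c • (Xᵀ * X) + l • (1 : Matrix k k ℝ))⁻¹ *ᵥ (c • (Xᵀ *ᵥ (X *ᵥ β + e)))
        + (l • (c • (Xᵀ * X) + l • (1 : Matrix k k ℝ))⁻¹) *ᵥ b
      = β + (l • (c • (Xᵀ * X) + l • (1 : Matrix k k ℝ))⁻¹) *ᵥ (b - β)
        + ((c • (Xᵀ * X) + l • (1 : Matrix k k ℝ))⁻¹ * (c • Xᵀ)) *ᵥ e := by
  have hu := (posDef_smul_transpose_mul_self_add_smul_one X hc hl).isUnit
  set M := c • (Xᵀ * X) + l • (1 : Matrix k k ℝ) with hM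
  have hres : c • (Xᵀ *ᵥ (X *ᵥ β + e)) = M *ᵥ β - l • β + (c • Xᵀ) *ᵥ e := by
    simp only [hM, mulVec_add, add_mulVec, smul_mulVec, one_mulVec, mulVec_mulVec, smul_add]
    abel
  have hinv : M⁻¹ *ᵥ (M *ᵥ β) = β := by
    rw [mulVec_mulVec, nonsing_inv_mul _ ((isUnit_iff_isUnit_det M).mp hu), one_mulVec]
  rw [hres, mulVec_add, mulVec_sub, hinv]
  simp only [mulVec_sub, mulVec_smul, smul_mulVec, mulVec_mulVec, Matrix.mul_smul]
  abel

theorem prodDesc_zero_succ {p : ℕ} (A : ℕ → Matrix (Fin p) (Fin p) ℝ) (t : ℕ) :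
    prodDesc A 0 (t + 1) = A (t + 1) * prodDesc A 0 t := by
  simp [prodDesc, List.range'_concat, add_comm]

theorem prodAsc_zero_succ {p : ℕ} (A : ℕ → Matrix (Fin p) (Fin p) ℝ) (t : ℕ) :
    prodAsc A 0 (t + 1) = prodAsc A 0 t * A (t + 1) := by
  simp [prodAsc, List.range'_concat, add_comm]

theorem prodAsc_eq_transpose_prodDesc {p : ℕ} {A : ℕ → Matrix (Fin p) (Fin p) ℝ} {T : ℕ}
    (hA : ∀ t, 1 ≤ t → t ≤ T → (A t)ᵀ = A t) :
    prodAsc A 0 T = (prodDesc A 0 T)ᵀ := by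
  induction T with
  | zero => simp [prodAsc, prodDesc]
  | succ t ih =>
    rw [prodAsc_zero_succ, prodDesc_zero_succ, transpose_mul, hA _ (by omega) le_rfl,
      ih fun s h1 h2 => hA s h1 (by omega)]

/-- **bias part of Lemma 1.** In the continual ridge setting with fixed
designs, mean-zero integrable noise, `y_t = X_t β + ε_t`, and `Σ₀` symmetric positive
semidefinite, the bias `(E β̂_T − β)ᵀ Σ₀ (E β̂_T − β)` equals
`βᵀ A_1 A_2 ⋯ A_T Σ₀ A_T ⋯ A_2 A_1 β`. -/
theorem continual_ridge_bias
    {Ω : Type} [MeasurableSpace Ω] (μ : Measure Ω) [IsProbabilityMeasure μ]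
    (T p : ℕ) (n : ℕ → ℕ)
    (X : (t : ℕ) → Matrix (Fin (n t)) (Fin p) ℝ)
    (β : Fin p → ℝ)
    (Sig0 : Matrix (Fin p) (Fin p) ℝ) (hSig0 : Sig0.PosSemidef)
    (ε : (t : ℕ) → Ω → Fin (n t) → ℝ)
    (hεint : ∀ t i, 1 ≤ t → t ≤ T → Integrable (fun ω => ε t ω i) μ)
    (hεmean : ∀ t i, 1 ≤ t → t ≤ T → ∫ ω, ε t ω i ∂μ = 0)
    (y : (t : ℕ) → Ω → Fin (n t) → ℝ)
    (hy : ∀ t ω, 1 ≤ t → t ≤ T → y t ω = (X t) *ᵥ β + ε t ω)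
    (lam : ℕ → ℝ) (hlam : ∀ t, 1 ≤ t → t ≤ T → 0 < lam t)
    (ridge : ℕ → Ω → Fin p → ℝ)
    (hridge : ∀ t ω, 1 ≤ t → t ≤ T →
      ridge t ω = ((n t : ℝ)⁻¹ • ((X t)ᵀ * X t) + lam t • (1 : Matrix (Fin p) (Fin p) ℝ))⁻¹
        *ᵥ ((n t : ℝ)⁻¹ • ((X t)ᵀ *ᵥ y t ω)))
    (A : ℕ → Matrix (Fin p) (Fin p) ℝ)
    (hA : ∀ t, 1 ≤ t → t ≤ T →
      A t = lam t • ((n t : ℝ)⁻¹ • ((X t)ᵀ * X t) + lam t • (1 : Matrix (Fin p) (Fin p) ℝ))⁻¹)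
    (βhat : ℕ → Ω → Fin p → ℝ)
    (hβ0 : ∀ ω, βhat 0 ω = 0)
    (hβrec : ∀ t ω, 1 ≤ t → t ≤ T → βhat t ω = ridge t ω + (A t) *ᵥ (βhat (t - 1) ω))
    (Eβhat : Fin p → ℝ) (hEβhat : ∀ i, Eβhat i = ∫ ω, βhat T ω i ∂μ) :
    (Eβhat - β) ⬝ᵥ (Sig0 *ᵥ (Eβhat - β))
      = β ⬝ᵥ ((prodAsc A 0 T * Sig0 * prodDesc A 0 T) *ᵥ β) := by
  have hstep : ∀ t ω, t + 1 ≤ T → βhat (t + 1) ω = β + A (t + 1) *ᵥ (βhat t ω - β)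
      + (((n (t + 1) : ℝ)⁻¹ • ((X (t + 1))ᵀ * X (t + 1))
        + lam (t + 1) • (1 : Matrix (Fin p) (Fin p) ℝ))⁻¹
        * ((n (t + 1) : ℝ)⁻¹ • (X (t + 1))ᵀ)) *ᵥ ε (t + 1) ω := by
    intro t ω ht
    have h1 : 1 ≤ t + 1 := by omega
    rw [hβrec _ _ h1 ht, hridge _ _ h1 ht, hy _ _ h1 ht, hA _ h1 ht, Nat.add_sub_cancel]
    exact ridge_step_error _ (by positivity) (hlam _ h1 ht) _ _ _
  have herr : ∀ t, t ≤ T → ∀ i, Integrable (fun ω => (βhat t ω - β) i) μ ∧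
      ∫ ω, (βhat t ω - β) i ∂μ = -(prodDesc A 0 t *ᵥ β) i := by
    intro t
    induction t with
    | zero => intro _ i; simp [hβ0, prodDesc]
    | succ t ih =>
      intro ht i
      have hprev := ih (by omega)
      obtain ⟨hAint, hAmean⟩ := integrable_mulVec_and_integral_mulVec (A (t + 1))
        (fun j => (hprev j).1) i
      obtain ⟨hNint, hNmean⟩ := integrable_mulVec_and_integral_mulVec
        (((n (t + 1) : ℝ)⁻¹ • ((X (t + 1))ᵀ * X (t + 1))
          + lam (t + 1) • (1 : Matrix (Fin p) (Fin p) ℝ))⁻¹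
          * ((n (t + 1) : ℝ)⁻¹ • (X (t + 1))ᵀ))
        (fun j => hεint (t + 1) j (by omega) ht) i
      have hdecomp : (fun ω => (βhat (t + 1) ω - β) i) = fun ω =>
          (A (t + 1) *ᵥ (βhat t ω - β)) i
          + ((((n (t + 1) : ℝ)⁻¹ • ((X (t + 1))ᵀ * X (t + 1))
            + lam (t + 1) • (1 : Matrix (Fin p) (Fin p) ℝ))⁻¹
            * ((n (t + 1) : ℝ)⁻¹ • (X (t + 1))ᵀ)) *ᵥ ε (t + 1) ω) i := by
        funext ω
        rw [hstep t ω ht]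
        simp only [Pi.sub_apply, Pi.add_apply]
        ring
      have hεzero : (fun j => ∫ ω, ε (t + 1) ω j ∂μ) = 0 :=
        funext fun j => hεmean (t + 1) j (by omega) ht
      have hmean : (fun j => ∫ ω, (βhat t ω - β) j ∂μ) = -(prodDesc A 0 t *ᵥ β) :=
        funext fun j => (hprev j).2
      rw [hdecomp]
      refine ⟨hAint.add hNint, ?_⟩
      rw [integral_add hAint hNint, hAmean, hNmean, hεzero, hmean, prodDesc_zero_succ,
        mulVec_zero, mulVec_neg, mulVec_mulVec]
      simp
  have hbias : Eβhat - β = -(prodDesc A 0 T *ᵥ β) := by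
    funext i
    obtain ⟨hint, hmean⟩ := herr T le_rfl i
    have hβint : Integrable (fun ω => βhat T ω i) μ :=
      (hint.add (integrable_const (β i))).congr (ae_of_all _ fun ω => by simp)
    rw [Pi.neg_apply, ← hmean, Pi.sub_apply, hEβhat]
    simp only [Pi.sub_apply]
    rw [integral_sub hβint (integrable_const _)]
    simp
  have hsymm : ∀ t, 1 ≤ t → t ≤ T → (A t)ᵀ = A t := by
    intro t h1 ht
    rw [hA t h1 ht]
    simp [transpose_nonsing_inv]
  rw [hbias, prodAsc_eq_transpose_prodDesc hsymm, mulVec_neg, neg_dotProduct_neg,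
    ← mulVec_mulVec, ← mulVec_mulVec, dotProduct_mulVec β, vecMul_transpose]
end
end
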